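/- arXiv:2601.22176 — 4 statements merged into one kernel-verified Lean document; each statement's English description precedes it below -/
import Mathlib

section
/- Let n be a positive even natural number and t : ZMod n with t.val odd, and let s : Fin n ≃ ZMod n be a series with s 0 = 0. Let σ be the proliferating permutation of s under retrograde inversion with transposition t. Then the full cycle type of σ is a doubled multiset: there exists a multiset μ of positive natural numbers with μ.sum = n / 2 such that the full cycle type of σ equals μ + μ. -/
/-- The full cycle type of a permutation: the multiset of the sizes of all its orbits,
with fixed points counted as orbits of size 1. -/
def fullCycleType {α : Type*} [Fintype α] [DecidableEq α] (σ : Equiv.Perm α) : Multiset ℕ :=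
  σ.cycleType + Multiset.replicate (Finset.univ.filter fun x => σ x = x).card 1

/-- A multiset obtained by mapping a finset along a function that is invariant under a
fixed-point-free involution is doubled. -/
theorem Finset.exists_map_eq_add_self {α β : Type*} [DecidableEq α] (f : α → α) (g : α → β)
    (S : Finset α) (hmem : ∀ x ∈ S, f x ∈ S) (hinv : ∀ x ∈ S, f (f x) = x)
    (hne : ∀ x ∈ S, f x ≠ x) (hg : ∀ x ∈ S, g (f x) = g x) :
    ∃ μ : Multiset β, S.val.map g = μ + μ := by
  induction S using Finset.strongInduction with
  | H S ih =>
    rcases S.eq_empty_or_nonempty with rfl | ⟨x, hx⟩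
    · exact ⟨0, rfl⟩
    · have hfx : f x ∈ S.erase x := Finset.mem_erase.2 ⟨hne x hx, hmem x hx⟩
      have hsub : (S.erase x).erase (f x) ⊂ S :=
        (Finset.erase_ssubset hfx).trans (Finset.erase_ssubset hx)
      obtain ⟨μ, hμ⟩ := ih _ hsub
        (fun y hy => by
          simp only [Finset.mem_erase] at hy ⊢
          refine ⟨fun h => hy.2.1 ?_, fun h => hy.1 ?_, hmem y hy.2.2⟩
          · rw [← hinv y hy.2.2, h, hinv x hx]
          · rw [← hinv y hy.2.2, h])
        (fun y hy => hinv y (hsub.1 hy)) (fun y hy => hne y (hsub.1 hy))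
        (fun y hy => hg y (hsub.1 hy))
      refine ⟨g x ::ₘ μ, ?_⟩
      rw [← Finset.insert_erase hx, ← Finset.insert_erase hfx,
        Finset.insert_val_of_notMem (by simp [(hne x hx).symm]),
        Finset.insert_val_of_notMem (by simp), Multiset.map_cons, Multiset.map_cons, hμ,
        hg x hx]
      simp

theorem Equiv.Perm.conj_inv_mem_cycleFactorsFinset {α : Type*} [Fintype α] [DecidableEq α]
    {σ b c : Equiv.Perm α} (h : b * σ * b⁻¹ = σ⁻¹) (hc : c ∈ σ.cycleFactorsFinset) :
    b * c⁻¹ * b⁻¹ ∈ σ.cycleFactorsFinset := by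
  have hσ : b * σ⁻¹ * b⁻¹ = σ := by
    rw [← conj_inv, h, inv_inv]
  rw [← hσ, Equiv.Perm.mem_cycleFactorsFinset_conj, Equiv.Perm.mem_cycleFactorsFinset_iff]
  rw [Equiv.Perm.mem_cycleFactorsFinset_iff] at hc
  refine ⟨hc.1.inv, fun x hx => ?_⟩
  rw [Equiv.Perm.support_inv] at hx
  have hx' : c⁻¹ x ∈ c.support := by
    rw [← Equiv.Perm.support_inv, Equiv.Perm.apply_mem_support, Equiv.Perm.support_inv]
    exact hx
  rw [Equiv.Perm.eq_inv_iff_eq, ← hc.2 _ hx']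
  exact Equiv.apply_symm_apply c x

/-- For fixed-point-free involutions `a` and `b`, no point lies in the same cycle of `a * b`
as its image under `b`. -/
theorem Equiv.Perm.not_sameCycle_mul_of_involutive {α : Type*} {a b : Equiv.Perm α}
    (ha : a * a = 1) (hb : b * b = 1) (ha' : ∀ x, a x ≠ x) (hb' : ∀ x, b x ≠ x) (x : α) :
    ¬ (a * b).SameCycle x (b x) := by
  have hai : a⁻¹ = a := inv_eq_of_mul_eq_one_left ha
  have hbi : b⁻¹ = b := inv_eq_of_mul_eq_one_left hb
  have hbc : SemiconjBy b (a * b) (a * b)⁻¹ := by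
    rw [SemiconjBy, mul_inv_rev, hai, hbi, mul_assoc]
  have hac : SemiconjBy a (a * b) (a * b)⁻¹ := by
    rw [SemiconjBy, mul_inv_rev, hai, hbi, ← mul_assoc, ha, mul_assoc, ha, one_mul, mul_one]
  rintro ⟨k, hk⟩
  have key : ∀ d : Equiv.Perm α, SemiconjBy d (a * b) (a * b)⁻¹ → ∀ m : ℤ,
      ((a * b) ^ (m + m)) x = d x → d (((a * b) ^ m) x) = ((a * b) ^ m) x := by
    intro d hd m hm
    have := congrArg (fun p : Equiv.Perm α => p x) (hd.zpow_right m).eq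
    simp only [Equiv.Perm.mul_apply d, Equiv.Perm.mul_apply _ d] at this
    rw [this, ← hm, ← Equiv.Perm.mul_apply, inv_zpow, zpow_add, inv_mul_cancel_left]
  rcases Int.even_or_odd k with ⟨m, rfl⟩ | ⟨m, rfl⟩
  · exact hb' _ (key b hbc m hk)
  · refine ha' _ (key a hac (m + 1) ?_)
    rw [show m + 1 + (m + 1) = 1 + (2 * m + 1) by ring, zpow_add, Equiv.Perm.mul_apply, hk,
      zpow_one, ← Equiv.Perm.mul_apply, mul_assoc, hb, mul_one]

theorem sum_fullCycleType {α : Type*} [Fintype α] [DecidableEq α] (σ : Equiv.Perm α) :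
    (fullCycleType σ).sum = Fintype.card α := by
  have h : (Finset.univ.filter fun x => σ x = x) = σ.supportᶜ := by
    ext x; simp
  rw [fullCycleType, Multiset.sum_add, Equiv.Perm.sum_cycleType, Multiset.sum_replicate, h,
    smul_eq_mul, mul_one, Finset.card_add_card_compl]

theorem pos_of_mem_fullCycleType {α : Type*} [Fintype α] [DecidableEq α] {σ : Equiv.Perm α}
    {c : ℕ} (hc : c ∈ fullCycleType σ) : 0 < c := by
  rcases Multiset.mem_add.1 hc with h | h
  · exact zero_lt_two.trans_le (Equiv.Perm.two_le_of_mem_cycleType h)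
  · rw [Multiset.eq_of_mem_replicate h]; exact one_pos

/-- The product of two fixed-point-free involutions has a doubled full cycle type. -/
theorem exists_fullCycleType_mul_eq_add_self {α : Type*} [Fintype α] [DecidableEq α]
    {a b : Equiv.Perm α} (ha : a * a = 1) (hb : b * b = 1) (ha' : ∀ x, a x ≠ x)
    (hb' : ∀ x, b x ≠ x) : ∃ μ : Multiset ℕ, fullCycleType (a * b) = μ + μ := by
  have hai : a⁻¹ = a := inv_eq_of_mul_eq_one_left ha
  have hbi : b⁻¹ = b := inv_eq_of_mul_eq_one_left hb
  have hconj : b * (a * b) * b⁻¹ = (a * b)⁻¹ := by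
    rw [mul_inv_rev, hai, ← mul_assoc, mul_inv_cancel_right, hbi]
  have hns := Equiv.Perm.not_sameCycle_mul_of_involutive ha hb ha' hb'
  obtain ⟨μ, hμ⟩ := Finset.exists_map_eq_add_self (fun c => b * c⁻¹ * b⁻¹)
    (Finset.card ∘ Equiv.Perm.support) (a * b).cycleFactorsFinset
    (fun c hc => Equiv.Perm.conj_inv_mem_cycleFactorsFinset hconj hc)
    (fun c _ => by
      simp only [mul_inv_rev, inv_inv, hbi]
      rw [← mul_assoc, ← mul_assoc, hb, one_mul, mul_assoc, hb, mul_one])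
    (fun c hc h => by
      have hc' := Equiv.Perm.mem_cycleFactorsFinset_iff.1 hc
      obtain ⟨x, hx⟩ := hc'.1.nonempty_support
      have hbx : c (b x) ≠ b x := by
        rw [← h]
        rw [Equiv.Perm.mul_apply, Equiv.Perm.mul_apply, Ne, b.injective.eq_iff,
          Equiv.Perm.inv_def b, Equiv.symm_apply_apply, Equiv.Perm.inv_eq_iff_eq]
        exact fun e => Equiv.Perm.mem_support.1 hx e.symm
      have hcyc := Equiv.Perm.cycle_is_cycleOf hx hc
      have hmem : b x ∈ ((a * b).cycleOf x).support := by
        rw [← hcyc]; exact Equiv.Perm.mem_support.2 hbx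
      exact hns x (Equiv.Perm.mem_support_cycleOf_iff.1 hmem).1)
    (fun c _ => by simp)
  obtain ⟨ν, hν⟩ := Finset.exists_map_eq_add_self b (fun _ => 1)
    (Finset.univ.filter fun x => (a * b) x = x)
    (fun x hx => by
      rw [Finset.mem_filter_univ, Equiv.Perm.mul_apply] at hx ⊢
      rw [← Equiv.Perm.mul_apply b b, hb, Equiv.Perm.one_apply]
      nth_rewrite 1 [← hx]
      rw [← Equiv.Perm.mul_apply a a, ha, Equiv.Perm.one_apply])
    (fun x _ => by rw [← Equiv.Perm.mul_apply, hb, Equiv.Perm.one_apply])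
    (fun x _ => hb' x) (fun _ _ => rfl)
  refine ⟨μ + ν, ?_⟩
  rw [Multiset.map_const', Finset.card_val] at hν
  rw [fullCycleType, Equiv.Perm.cycleType_def, hμ, hν, add_add_add_comm]

theorem ZMod.sub_self_ne_of_odd_val {n : ℕ} [NeZero n] (hn : Even n) {t : ZMod n}
    (ht : Odd t.val) (x : ZMod n) : t - x ≠ x := by
  intro h
  have h' : t = x + x := by rw [← sub_eq_iff_eq_add, h]
  rw [h', ZMod.val_add, ← Nat.not_even_iff_odd] at ht
  exact ht ((Even.mod_even_iff hn).2 ⟨_, rfl⟩)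

theorem Fin.rev_ne_self_of_even {n : ℕ} (hn : Even n) (i : Fin n) : Fin.rev i ≠ i := by
  intro h
  have := congrArg Fin.val h
  rw [Fin.val_rev] at this
  obtain ⟨m, rfl⟩ := hn
  omega


/-- for `n` even and `t.val` odd, the full cycle type of the RI proliferating
permutation is a doubled multiset `μ + μ` with `μ.sum = n / 2`. -/
theorem stmt_5 (n : ℕ) [NeZero n] (hn : Even n) (t : ZMod n) (ht : Odd t.val)
    (s : Fin n ≃ ZMod n) (hs : s 0 = 0)
    (σ : Equiv.Perm (ZMod n)) (hσ : ∀ x : ZMod n, σ x = t - s (Fin.rev (s.symm x))) :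
    ∃ μ : Multiset ℕ, (∀ c ∈ μ, 0 < c) ∧ μ.sum = n / 2 ∧ fullCycleType σ = μ + μ := by
  let a : Equiv.Perm (ZMod n) := Equiv.subLeft t
  let b : Equiv.Perm (ZMod n) := (s.symm.trans Fin.revPerm).trans s
  have hab : σ = a * b := by
    ext x; rw [hσ]; rfl
  obtain ⟨μ, hμ⟩ := exists_fullCycleType_mul_eq_add_self (a := a) (b := b)
    (by ext x; simp [a]) (by ext x; simp [b])
    (fun x => ZMod.sub_self_ne_of_odd_val hn ht x)
    (fun x h => Fin.rev_ne_self_of_even hn (s.symm x) (s.eq_symm_apply.2 h))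
  rw [← hab] at hμ
  refine ⟨μ, fun c hc => ?_, ?_, hμ⟩
  · exact pos_of_mem_fullCycleType (σ := σ) (hμ ▸ Multiset.mem_add.2 (Or.inl hc))
  · have := sum_fullCycleType σ
    rw [hμ, Multiset.sum_add, ZMod.card] at this
    omega
end

section
/- Let n be a positive even natural number and t : ZMod n with t.val even. Then for every even natural number k with 2 ≤ k ≤ n and every multiset μ of positive natural numbers with k + 2 · μ.sum = n, there exists a series s : Fin n ≃ ZMod n with s 0 = 0 such that the full cycle type of the proliferating permutation of s under retrograde inversion with transposition t equals k ::ₘ (μ + μ). -/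
/-- The proliferating permutation of a series `s` under retrograde inversion with
transposition `t`: `x ↦ t - s (rev (s.symm x))`. -/
def ppRI {n : ℕ} [NeZero n] (t : ZMod n) (s : Fin n ≃ ZMod n) : Equiv.Perm (ZMod n) :=
  (s.symm.trans (Fin.revPerm.trans s)).trans (Equiv.subLeft t)

open Equiv in
theorem fullCycleType_inv {α : Type*} [Fintype α] [DecidableEq α] (σ : Perm α) :
    fullCycleType σ⁻¹ = fullCycleType σ := by
  have hiff (x : α) : σ⁻¹ x = x ↔ σ x = x := by rw [Perm.inv_eq_iff_eq, eq_comm]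
  simp only [fullCycleType, Perm.cycleType_inv, hiff]

theorem cycleType_permCongr {α β : Type*} [Fintype α] [DecidableEq α] [Fintype β] [DecidableEq β]
    (e : α ≃ β) (σ : Equiv.Perm α) : (e.permCongr σ).cycleType = σ.cycleType := by
  rw [← Equiv.Perm.cycleType_extendDomain
    (e.trans (Equiv.subtypeUnivEquiv (p := fun _ : β => True) fun _ => trivial).symm) (g := σ)]
  congr 1

theorem card_fixed_permCongr {α β : Type*} [Fintype α] [DecidableEq α] [Fintype β] [DecidableEq β]
    (e : α ≃ β) (σ : Equiv.Perm α) :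
    (Finset.univ.filter fun x => e.permCongr σ x = x).card =
      (Finset.univ.filter fun x => σ x = x).card := by
  refine Finset.card_equiv e.symm fun x => ?_
  simp [Equiv.permCongr_apply, ← Equiv.eq_symm_apply]

theorem fullCycleType_permCongr {α β : Type*} [Fintype α] [DecidableEq α] [Fintype β]
    [DecidableEq β] (e : α ≃ β) (σ : Equiv.Perm α) :
    fullCycleType (e.permCongr σ) = fullCycleType σ := by
  rw [fullCycleType, fullCycleType, cycleType_permCongr, card_fixed_permCongr]

open Equiv in
theorem cycleType_sumCongr {α β : Type*} [Fintype α] [DecidableEq α] [Fintype β] [DecidableEq β]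
    (σ : Perm α) (τ : Perm β) :
    Perm.cycleType (sumCongr σ τ : Perm (α ⊕ β)) = σ.cycleType + τ.cycleType := by
  have hl : (sumCongr σ 1 : Perm (α ⊕ β)) =
      σ.extendDomain (ofInjective (Sum.inl : α → α ⊕ β) Sum.inl_injective) := by
    ext (a | b)
    · exact (Perm.extendDomain_apply_image σ (ofInjective _ Sum.inl_injective) a).symm
    · rw [Perm.extendDomain_apply_not_subtype _ _ (by simp)]; rfl
  have hr : (sumCongr 1 τ : Perm (α ⊕ β)) =
      τ.extendDomain (ofInjective (Sum.inr : β → α ⊕ β) Sum.inr_injective) := by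
    ext (a | b)
    · rw [Perm.extendDomain_apply_not_subtype _ _ (by simp)]; rfl
    · exact (Perm.extendDomain_apply_image τ (ofInjective _ Sum.inr_injective) b).symm
  have hmul : (sumCongr σ τ : Perm (α ⊕ β)) =
      (sumCongr σ 1 : Perm (α ⊕ β)) * (sumCongr 1 τ : Perm (α ⊕ β)) := by
    ext (a | b) <;> rfl
  have hd : Perm.Disjoint (sumCongr σ 1 : Perm (α ⊕ β)) (sumCongr 1 τ : Perm (α ⊕ β)) := by
    rintro (a | b)
    · exact Or.inr rfl
    · exact Or.inl rfl
  rw [hmul, hd.cycleType_mul, hl, hr, Perm.cycleType_extendDomain, Perm.cycleType_extendDomain]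

theorem card_fixed_sumCongr {α β : Type*} [Fintype α] [DecidableEq α] [Fintype β] [DecidableEq β]
    (σ : Equiv.Perm α) (τ : Equiv.Perm β) :
    (Finset.univ.filter fun x => Equiv.sumCongr σ τ x = x).card =
      (Finset.univ.filter fun x => σ x = x).card + (Finset.univ.filter fun x => τ x = x).card := by
  rw [← Finset.card_disjSum]
  congr 1
  ext (a | b) <;> simp

theorem fullCycleType_sumCongr {α β : Type*} [Fintype α] [DecidableEq α] [Fintype β]
    [DecidableEq β] (σ : Equiv.Perm α) (τ : Equiv.Perm β) :
    fullCycleType (Equiv.sumCongr σ τ : Equiv.Perm (α ⊕ β)) =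
      fullCycleType σ + fullCycleType τ := by
  rw [fullCycleType, fullCycleType, fullCycleType, cycleType_sumCongr, card_fixed_sumCongr,
    Multiset.replicate_add, add_add_add_comm]

theorem fullCycleType_addRight_one (c : ℕ) [NeZero c] :
    fullCycleType (Equiv.addRight (1 : ZMod c)) = {c} := by
  obtain rfl | hc := eq_or_ne c 1
  · have h : Equiv.addRight (1 : ZMod 1) = 1 := Subsingleton.elim _ _
    rw [h]
    rfl
  have : Fact (1 < c) := ⟨by have := NeZero.ne c; omega⟩
  have hne (x : ZMod c) : Equiv.addRight (1 : ZMod c) x ≠ x := by simp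
  have hcyc : (Equiv.addRight (1 : ZMod c)).IsCycle := by
    refine ⟨0, hne 0, fun y _ => ⟨y.val, ?_⟩⟩
    simp
  have hsupp : (Equiv.addRight (1 : ZMod c)).support = Finset.univ := by
    ext x
    simp
  rw [fullCycleType, hcyc.cycleType, hsupp, Finset.filter_false_of_mem fun x _ => hne x]
  simp [ZMod.card]

theorem fullCycleType_addRight_neg_one (c : ℕ) [NeZero c] :
    fullCycleType (Equiv.addRight (-1 : ZMod c)) = {c} := by
  rw [← fullCycleType_addRight_one c, ← fullCycleType_inv (Equiv.addRight (1 : ZMod c))]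
  congr 1
  simp

theorem card_fixed_subLeft {n : ℕ} [NeZero n] (hn : Even n) (h : ZMod n) :
    (Finset.univ.filter fun x => Equiv.subLeft (h + h) x = x).card = 2 := by
  obtain ⟨m, rfl⟩ := hn
  have hm : 0 < m := by have := NeZero.ne (m + m); omega
  have hval : (m : ZMod (m + m)).val = m := ZMod.val_cast_of_lt (by omega)
  have hm0 : (m : ZMod (m + m)) ≠ 0 := fun h0 => by
    rw [h0, ZMod.val_zero] at hval
    omega
  rw [Finset.card_eq_two]
  refine ⟨h, h + m, by simpa using hm0, ?_⟩
  ext x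
  have key := ZMod.neg_eq_self_iff (x - h)
  have hl : Equiv.subLeft (h + h) x = x ↔ -(x - h) = x - h := by
    rw [Equiv.subLeft_apply]
    constructor <;> intro e <;> linear_combination e
  have hr : 2 * (x - h).val = m + m ↔ x = h + m := by
    constructor
    · intro e
      have : (x - h).val = m := by omega
      rw [← sub_eq_iff_eq_add', ← ZMod.natCast_zmod_val (x - h), this]
    · rintro rfl
      rw [add_sub_cancel_left, hval]
      omega
  simp only [Finset.mem_filter, Finset.mem_univ, true_and, Finset.mem_insert,
    Finset.mem_singleton]
  rw [hl, key, hr, sub_eq_zero]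

open Equiv in
theorem exists_involutions_mul (k : ℕ) (hk : Even k) (hk2 : 2 ≤ k) (μ : Multiset ℕ)
    (hμ : ∀ c ∈ μ, 0 < c) :
    ∃ (α : Type) (_ : Fintype α) (_ : DecidableEq α) (f g : Perm α),
      f ^ 2 = 1 ∧ g ^ 2 = 1 ∧ (Finset.univ.filter fun x => f x = x).card = 2 ∧
      (Finset.univ.filter fun x => g x = x).card = 0 ∧
      fullCycleType (f * g) = k ::ₘ (μ + μ) := by
  induction μ using Multiset.induction with
  | empty =>
    have : NeZero k := ⟨by omega⟩
    refine ⟨ZMod k, inferInstance, inferInstance, Equiv.subLeft 0, Equiv.subLeft (-1), ?_, ?_, ?_, ?_, ?_⟩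
    · ext x; simp [sq]
    · ext x; simp [sq]
    · simpa using card_fixed_subLeft hk (0 : ZMod k)
    · rw [Finset.card_eq_zero, Finset.filter_eq_empty_iff]
      intro x _ hx
      have h2 : (x + x + 1 : ZMod k) = 0 := by
        rw [Equiv.subLeft_apply] at hx
        linear_combination -hx
      have h3 : ((2 * x.val + 1 : ℕ) : ZMod k) = 0 := by
        push_cast
        rw [ZMod.natCast_zmod_val]
        linear_combination h2
      have h4 := hk.two_dvd.trans ((ZMod.natCast_eq_zero_iff _ _).1 h3)
      omega
    · rw [show Equiv.subLeft (0 : ZMod k) * Equiv.subLeft (-1) = Equiv.addRight 1 by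
        ext x; simp]
      simpa using fullCycleType_addRight_one k
  | cons c μ ih =>
    obtain ⟨α, _, _, f, g, hf, hg, hff, hgf, hfg⟩ :=
      ih fun d hd => hμ d (Multiset.mem_cons_of_mem hd)
    have : NeZero c := ⟨(hμ c (Multiset.mem_cons_self c μ)).ne'⟩
    let ρ : Perm (ZMod c ⊕ ZMod c) := sumCongr (Equiv.addRight 1) (Equiv.addRight (-1))
    let γ : Perm (ZMod c ⊕ ZMod c) := sumComm _ _
    have hγ : γ * γ = 1 := by ext (x | x) <;> rfl
    refine ⟨α ⊕ (ZMod c ⊕ ZMod c), inferInstance, inferInstance, sumCongr f (ρ * γ),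
      sumCongr g γ, ?_, ?_, ?_, ?_, ?_⟩
    · ext (x | x | x)
      · simpa [sq] using DFunLike.congr_fun hf x
      · simp [sq, ρ, γ]
      · simp [sq, ρ, γ]
    · ext (x | x | x)
      · simpa [sq] using DFunLike.congr_fun hg x
      · simp [sq, γ]
      · simp [sq, γ]
    · rw [card_fixed_sumCongr, hff, Nat.add_eq_left, Finset.card_eq_zero,
        Finset.filter_eq_empty_iff]
      rintro (x | x) _ <;> simp [ρ, γ]
    · rw [card_fixed_sumCongr, hgf, zero_add, Finset.card_eq_zero, Finset.filter_eq_empty_iff]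
      rintro (x | x) _ <;> simp [γ]
    · have hmul : (sumCongr f (ρ * γ) * sumCongr g γ : Perm (α ⊕ (ZMod c ⊕ ZMod c))) =
          sumCongr (f * g) ρ := by
        rw [Perm.sumCongr_mul, mul_assoc, hγ, mul_one]
      rw [hmul, fullCycleType_sumCongr, hfg, fullCycleType_sumCongr, fullCycleType_addRight_one,
        fullCycleType_addRight_neg_one]
      simp only [← Multiset.singleton_add]
      abel

theorem exists_permCongr_eq_of_involutive {α β : Type*} [Fintype α] [DecidableEq α] [Fintype β]
    [DecidableEq β] {f : Equiv.Perm α} {g : Equiv.Perm β} (hf : f ^ 2 = 1) (hg : g ^ 2 = 1)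
    (hcard : Fintype.card α = Fintype.card β)
    (hfix : (Finset.univ.filter fun x => f x = x).card =
      (Finset.univ.filter fun x => g x = x).card) :
    ∃ e : α ≃ β, e.permCongr f = g := by
  have e₀ := Fintype.equivOfCardEq hcard
  have hct : f.cycleType = g.cycleType := by
    have h₁ := sum_fullCycleType f
    have h₂ := sum_fullCycleType g
    rw [fullCycleType, Equiv.Perm.cycleType_of_pow_prime_eq_one hf] at h₁
    rw [fullCycleType, Equiv.Perm.cycleType_of_pow_prime_eq_one hg] at h₂
    simp only [Multiset.sum_add, Multiset.sum_replicate, smul_eq_mul] at h₁ h₂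
    rw [Equiv.Perm.cycleType_of_pow_prime_eq_one hf, Equiv.Perm.cycleType_of_pow_prime_eq_one hg]
    congr 1
    omega
  rw [← cycleType_permCongr e₀ f, ← Equiv.Perm.isConj_iff_cycleType_eq, isConj_iff] at hct
  obtain ⟨π, hπ⟩ := hct
  refine ⟨e₀.trans π, ?_⟩
  rw [← hπ]
  rfl

open Equiv in
/-- The centralizer of a fixed-point-free involution is transitive. -/
theorem exists_commute_apply_eq {α : Type*} [DecidableEq α] {g : Perm α} (hg : g ^ 2 = 1)
    (hfix : ∀ x, g x ≠ x) (a b : α) : ∃ π : Perm α, g.permCongr π = π ∧ π a = b := by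
  have hgg (x : α) : g (g x) = x := by simpa [sq] using DFunLike.congr_fun hg x
  have hsymm (x : α) : g.symm x = g x := by rw [symm_apply_eq, hgg]
  obtain rfl | hab := eq_or_ne b a
  · exact ⟨1, by ext x; simp, rfl⟩
  obtain rfl | hgab := eq_or_ne b (g a)
  · exact ⟨g, by ext x; simp, rfl⟩
  refine ⟨swap a b * swap (g a) (g b), ?_, ?_⟩
  · have h₁ (x y : α) : g * swap x y = swap (g x) (g y) * g := mul_swap_eq_swap_mul g x y
    have hd : swap a b * swap (g a) (g b) = swap (g a) (g b) * swap a b := by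
      refine Perm.Disjoint.commute (Perm.disjoint_swap_swap ?_)
      have h₂ := hfix a
      have h₃ := hfix b
      have h₄ : a ≠ g b := fun h => hgab (by rw [h, hgg])
      simp [hgab, h₂.symm, h₃.symm, h₄, hab.symm]
    have : g * (swap a b * swap (g a) (g b)) * g⁻¹ = swap a b * swap (g a) (g b) := by
      rw [mul_inv_eq_iff_eq_mul, ← mul_assoc, h₁, mul_assoc, h₁, hgg, hgg, ← mul_assoc, hd]
    exact this
  · have h₄ : a ≠ g b := fun h => hgab (by rw [h, hgg])
    rw [Perm.mul_apply, swap_apply_of_ne_of_ne (hfix a).symm h₄, swap_apply_left]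


/-- for `n` even and `t.val` even, every structure `k ::ₘ (μ + μ)` with
`k` even, `2 ≤ k ≤ n`, `μ` a multiset of positive naturals and `k + 2 * μ.sum = n`, is
realized as the full cycle type of the RI proliferating permutation of some series. -/
theorem stmt_8 (n : ℕ) [NeZero n] (hn : Even n) (t : ZMod n) (ht : Even t.val)
    (k : ℕ) (hk : Even k) (hk2 : 2 ≤ k) (hkn : k ≤ n)
    (μ : Multiset ℕ) (hμ : ∀ c ∈ μ, 0 < c) (hsum : k + 2 * μ.sum = n) :
    ∃ s : Fin n ≃ ZMod n, s 0 = 0 ∧ fullCycleType (ppRI t s) = k ::ₘ (μ + μ) := by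
  obtain ⟨α, _, _, f, g, hf, hg, hff, hgf, hfg⟩ := exists_involutions_mul k hk hk2 μ hμ
  have hcard : Fintype.card α = n := by
    rw [← sum_fullCycleType (f * g), hfg, ← hsum]
    simp [two_mul]
  obtain ⟨h, rfl⟩ : ∃ h : ZMod n, t = h + h := by
    obtain ⟨m, hm⟩ := ht
    exact ⟨m, by rw [← Nat.cast_add, ← hm, ZMod.natCast_zmod_val]⟩
  obtain ⟨e, he⟩ := exists_permCongr_eq_of_involutive (g := Equiv.subLeft (h + h)) hf
    (by ext x; simp [sq]) (by rw [hcard, ZMod.card]) (by rw [hff, card_fixed_subLeft hn h])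
  have hrev : (Fin.revPerm : Equiv.Perm (Fin n)) ^ 2 = 1 := by ext x; simp [sq]
  have hrevfix (x : Fin n) : Fin.revPerm x ≠ x := by
    intro hx
    obtain ⟨m, hm⟩ := hn
    have := congrArg Fin.val hx
    rw [Fin.revPerm_apply, Fin.val_rev] at this
    omega
  obtain ⟨s₀, hs₀⟩ := exists_permCongr_eq_of_involutive (f := (Fin.revPerm : Equiv.Perm (Fin n)))
    (g := e.permCongr g) hrev (by rw [← map_one e.permCongrHom, ← hg, map_pow]; rfl)
    (by simp [ZMod.card])
    (by rw [card_fixed_permCongr, hgf, Finset.card_eq_zero, Finset.filter_eq_empty_iff]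
        exact fun x _ => hrevfix x)
  obtain ⟨π, hπ, hπ0⟩ := exists_commute_apply_eq hrev hrevfix 0 (s₀.symm 0)
  refine ⟨π.trans s₀, by simp [hπ0], ?_⟩
  rw [← hfg, ← fullCycleType_permCongr e]
  congr 1
  have hcomm (x : Fin n) : π (Fin.rev (π.symm x)) = Fin.rev x := by
    simpa using (DFunLike.congr_fun hπ (Fin.rev (π.symm x))).symm
  ext x
  have hx : s₀ (Fin.rev (s₀.symm x)) = e (g (e.symm x)) := DFunLike.congr_fun hs₀ x
  have hfe (y : α) : h + h - e y = e (f y) := by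
    simpa using (DFunLike.congr_fun he (e y)).symm
  simp [ppRI, hcomm, hx, hfe]
end

section
/- Let n be an odd natural number with n ≥ 3, let t : ZMod n, and let s : Fin n ≃ ZMod n be a series with s 0 = 0. Let σ be the proliferating permutation of s under retrograde inversion with transposition t, and let a be the unique element of ZMod n with a + a = t. Then the σ-orbit of a has odd size k, there exists a multiset μ of positive natural numbers with k + 2 · μ.sum = n such that the full cycle type of σ equals k ::ₘ (μ + μ), and moreover if t = 0 then k ≥ 3. -/
theorem exists_map_eq_add_self_of_involution {β γ : Type*} [DecidableEq β] (f : β → γ) (g : β → β)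
    (S : Finset β) (hmem : ∀ x ∈ S, g x ∈ S) (hinv : ∀ x ∈ S, g (g x) = x)
    (hf : ∀ x ∈ S, f (g x) = f x) (hne : ∀ x ∈ S, g x ≠ x) :
    ∃ μ : Multiset γ, S.val.map f = μ + μ := by
  induction S using Finset.strongInduction with
  | H S ih =>
    rcases S.eq_empty_or_nonempty with rfl | ⟨x, hx⟩
    · exact ⟨0, by simp⟩
    · have hgx : g x ∈ S.erase x := Finset.mem_erase.2 ⟨hne x hx, hmem x hx⟩
      obtain ⟨μ, hμ⟩ := ih ((S.erase x).erase (g x))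
        ((Finset.erase_ssubset hgx).trans (Finset.erase_ssubset hx))
        (fun y hy => by
          simp only [Finset.mem_erase] at hy ⊢
          refine ⟨fun h => hy.2.1 ?_, fun h => hy.1 ?_, hmem y hy.2.2⟩
          · rw [← hinv y hy.2.2, h, hinv x hx]
          · rw [← h, hinv y hy.2.2])
        (fun y hy => hinv y (Finset.mem_of_mem_erase (Finset.mem_of_mem_erase hy)))
        (fun y hy => hf y (Finset.mem_of_mem_erase (Finset.mem_of_mem_erase hy)))
        (fun y hy => hne y (Finset.mem_of_mem_erase (Finset.mem_of_mem_erase hy)))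
      refine ⟨f x ::ₘ μ, ?_⟩
      rw [← Finset.insert_erase hx, Finset.insert_val_of_notMem (Finset.notMem_erase _ _),
        ← Finset.insert_erase hgx, Finset.insert_val_of_notMem (Finset.notMem_erase _ _),
        Multiset.map_cons, Multiset.map_cons, hμ, hf x hx]
      simp

theorem Equiv.Perm.inv_mem_cycleFactorsFinset_inv {α : Type*} [Fintype α] [DecidableEq α]
    {σ f : Equiv.Perm α} (hf : f ∈ σ.cycleFactorsFinset) : f⁻¹ ∈ σ⁻¹.cycleFactorsFinset := by
  rw [mem_cycleFactorsFinset_iff] at hf ⊢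
  refine ⟨hf.1.inv, fun x hx => ?_⟩
  have hx' : f⁻¹ x ∈ f.support := by
    rw [support_inv] at hx
    rwa [← apply_mem_support, ← mul_apply, mul_inv_cancel, one_apply]
  rw [eq_inv_iff_eq, ← hf.2 _ hx', ← mul_apply, mul_inv_cancel, one_apply]

section Reversible

variable {α : Type*} {I σ : Equiv.Perm α}

theorem apply_zpow_of_conj_eq_inv (hconj : I * σ * I⁻¹ = σ⁻¹) (m : ℤ) (x : α) :
    I ((σ ^ m) x) = (σ ^ (-m)) (I x) := by
  have h : I * σ ^ m = σ ^ (-m) * I := by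
    rw [← mul_inv_eq_iff_eq_mul, ← conj_zpow, hconj, inv_zpow']
  exact congrArg (fun τ : Equiv.Perm α => τ x) h

/-- If `σ = I * (I * σ)` is a product of two involutions, of which the first fixes at most `a` and
the second has at most one fixed point, then every orbit of `σ` stable under `I` contains `a`. -/
theorem sameCycle_of_sameCycle_apply [Finite α] (hconj : I * σ * I⁻¹ = σ⁻¹) {a : α}
    (hfix : ∀ x, I x = x → x = a) (hfix' : ∀ x y, I (σ x) = x → I (σ y) = y → x = y)
    {x : α} (hx : σ.SameCycle x (I x)) : σ.SameCycle a x := by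
  have even_case : ∀ j : ℤ, (σ ^ (j + j)) x = I x → σ.SameCycle a x := by
    intro j hj
    refine Equiv.Perm.SameCycle.symm ⟨j, hfix _ ?_⟩
    rw [apply_zpow_of_conj_eq_inv hconj, ← hj, ← Equiv.Perm.mul_apply, ← zpow_add,
      neg_add_cancel_left]
  obtain ⟨m, hm⟩ := hx
  rcases Int.even_or_odd m with ⟨j, rfl⟩ | ⟨j, rfl⟩
  · exact even_case j hm
  set k := Function.minimalPeriod σ x
  have hkx : (σ ^ k) x = x := by
    rw [← Equiv.Perm.iterate_eq_pow]
    exact Function.isPeriodicPt_minimalPeriod σ x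
  have hkpos : 0 < k := Function.minimalPeriod_pos_of_mem_periodicPts
    (Function.mem_periodicPts.2 ⟨orderOf σ, orderOf_pos σ, by
      rw [Function.IsPeriodicPt, Function.IsFixedPt, Equiv.Perm.iterate_eq_pow,
        pow_orderOf_eq_one, Equiv.Perm.one_apply]⟩)
  rcases Nat.even_or_odd k with ⟨h, hh⟩ | ⟨h, hh⟩
  · have key : ∀ i : ℤ, (σ ^ (2 * j + 1)) x = (σ ^ (2 * i + 1)) x →
        I (σ ((σ ^ i) x)) = (σ ^ i) x := by
      intro i hi
      rw [← Equiv.Perm.mul_apply σ, ← zpow_one_add, apply_zpow_of_conj_eq_inv hconj, ← hm, hi,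
        ← Equiv.Perm.mul_apply, ← zpow_add]
      congr 2; ring
    have hshift : (σ ^ (2 * j + 1)) x = (σ ^ (2 * (j + h) + 1)) x := by
      have : (2 * (j + h) + 1 : ℤ) = (2 * j + 1) + (k : ℕ) := by rw [hh]; push_cast; ring
      rw [this, zpow_add σ (2 * j + 1) k, Equiv.Perm.mul_apply, zpow_natCast, hkx]
    have heq := hfix' _ _ (key j rfl) (key (j + h) hshift)
    rw [zpow_add, Equiv.Perm.mul_apply, zpow_natCast] at heq
    have hper : Function.IsPeriodicPt σ h x := by
      rw [Function.IsPeriodicPt, Function.IsFixedPt, Equiv.Perm.iterate_eq_pow]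
      exact ((σ ^ j).injective heq).symm
    exact absurd hper (Function.not_isPeriodicPt_of_pos_of_lt_minimalPeriod (by omega) (by omega))
  · refine even_case (j + h + 1) ?_
    have : ((j + h + 1) + (j + h + 1) : ℤ) = (2 * j + 1) + (k : ℕ) := by rw [hh]; push_cast; ring
    rw [this, zpow_add σ (2 * j + 1) k, Equiv.Perm.mul_apply, zpow_natCast, hkx, hm]

theorem exists_fullCycleType_eq_cons_add_self [Fintype α] [DecidableEq α]
    (hconj : I * σ * I⁻¹ = σ⁻¹) (hI : ∀ x, I (I x) = x) {a : α} (ha : I a = a)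
    (hfix : ∀ x, I x = x → x = a) (hfix' : ∀ x y, I (σ x) = x → I (σ y) = y → x = y) :
    ∃ μ : Multiset ℕ,
      fullCycleType σ = Set.ncard {y : α | ∃ m : ℤ, (σ ^ m) a = y} ::ₘ (μ + μ) := by
  have hII : I⁻¹ = I := by ext x; rw [Equiv.Perm.inv_eq_iff_eq, hI]
  have hconj' : I * σ⁻¹ * I⁻¹ = σ := by
    rw [← hconj, hII]; ext x; simp [hI]
  obtain ⟨μ, hμ⟩ := exists_map_eq_add_self_of_involution
    (Finset.card ∘ Equiv.Perm.support) (fun f => I * f⁻¹ * I⁻¹)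
    (σ.cycleFactorsFinset.erase (σ.cycleOf a))
    (fun f hf => by
      have hne := Finset.ne_of_mem_erase hf
      have hf := Finset.mem_of_mem_erase hf
      have hmem : I * f⁻¹ * I⁻¹ ∈ σ.cycleFactorsFinset := by
        have := (Equiv.Perm.mem_cycleFactorsFinset_conj σ⁻¹ I f⁻¹).2
          (Equiv.Perm.inv_mem_cycleFactorsFinset_inv hf)
        rwa [hconj'] at this
      refine Finset.mem_erase.2 ⟨fun h => hne ?_, hmem⟩
      have haf : a ∈ (I * f⁻¹ * I⁻¹).support := by
        rw [h, Equiv.Perm.mem_support_cycleOf_iff, ← Equiv.Perm.cycleOf_mem_cycleFactorsFinset_iff,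
          ← h]
        exact ⟨Equiv.Perm.SameCycle.refl _ _, hmem⟩
      refine Equiv.Perm.cycle_is_cycleOf ?_ hf
      rw [Equiv.Perm.mem_support, hII] at haf
      rw [← Equiv.Perm.support_inv, Equiv.Perm.mem_support]
      intro h'
      apply haf
      rw [Equiv.Perm.mul_apply, Equiv.Perm.mul_apply, ha, h', ha])
    (fun f _ => by ext x; simp [hII, hI])
    (fun f _ => by simp)
    (fun f hf h => by
      have hne := Finset.ne_of_mem_erase hf
      have hf := Finset.mem_of_mem_erase hf
      obtain ⟨x, hx⟩ := (Equiv.Perm.mem_cycleFactorsFinset_iff.1 hf).1.nonempty_support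
      have hfx := Equiv.Perm.cycle_is_cycleOf hx hf
      have hIx : I x ∈ f.support := by
        rw [Equiv.Perm.mem_support] at hx ⊢
        intro h'
        rw [← h, hII] at h'
        simp only [Equiv.Perm.mul_apply, hI, EmbeddingLike.apply_eq_iff_eq] at h'
        exact hx (Equiv.Perm.inv_eq_iff_eq.1 h').symm
      rw [hfx, Equiv.Perm.mem_support_cycleOf_iff] at hIx
      exact hne (hfx.trans (sameCycle_of_sameCycle_apply hconj hfix hfix' hIx.1).cycleOf_eq.symm))
  obtain ⟨ν, hν⟩ := exists_map_eq_add_self_of_involution (fun _ => 1) I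
    ((Finset.univ.filter fun x => σ x = x).erase a)
    (fun x hx => by
      simp only [Finset.mem_erase, Finset.mem_filter, Finset.mem_univ, true_and] at hx ⊢
      refine ⟨fun h => hx.1 ?_, ?_⟩
      · rw [← hI x, h, ha]
      · have := apply_zpow_of_conj_eq_inv hconj (-1) x
        rw [neg_neg, zpow_one, zpow_neg_one] at this
        rw [← this, Equiv.Perm.inv_eq_iff_eq.2 hx.2.symm])
    (fun x _ => hI x) (fun _ _ => rfl)
    (fun x hx h => Finset.ne_of_mem_erase hx (hfix x h))
  refine ⟨μ + ν, ?_⟩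
  have hrep : Multiset.replicate (Finset.univ.filter fun x => σ x = x).card 1 =
      (Finset.univ.filter fun x => σ x = x).val.map (fun _ => 1) := by
    rw [Multiset.map_const']; rfl
  rw [fullCycleType, Equiv.Perm.cycleType_def, hrep]
  by_cases h : σ a = a
  · have horb : {y : α | ∃ m : ℤ, (σ ^ m) a = y} = {a} := by
      ext y
      simp only [Set.mem_ofPred_eq, Set.mem_singleton_iff,
        Equiv.Perm.zpow_apply_eq_self_of_apply_eq_self h, exists_const, eq_comm]
    have hmem : a ∈ Finset.univ.filter fun x => σ x = x := by simpa using h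
    rw [Finset.erase_eq_of_notMem (by
      rw [Equiv.Perm.cycleOf_mem_cycleFactorsFinset_iff, Equiv.Perm.notMem_support]
      exact h)] at hμ
    rw [horb, Set.ncard_singleton, hμ, ← Finset.insert_erase hmem,
      Finset.insert_val_of_notMem (Finset.notMem_erase _ _), Multiset.map_cons, hν,
      Multiset.add_cons, add_add_add_comm]
  · have horb : {y : α | ∃ m : ℤ, (σ ^ m) a = y} = (σ.cycleOf a).support := by
      ext y
      rw [Finset.mem_coe, Equiv.Perm.mem_support_cycleOf_iff' h]
      rfl
    have hmem : σ.cycleOf a ∈ σ.cycleFactorsFinset := by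
      rwa [Equiv.Perm.cycleOf_mem_cycleFactorsFinset_iff, Equiv.Perm.mem_support]
    rw [Finset.erase_eq_of_notMem (by simpa using h)] at hν
    rw [horb, Set.ncard_coe_finset, hν, ← Finset.insert_erase hmem,
      Finset.insert_val_of_notMem (Finset.notMem_erase _ _), Multiset.map_cons, hμ,
      Multiset.cons_add, add_add_add_comm]
    rfl

end Reversible

/-- for `n` odd, `n ≥ 3`, the cycle of the unique self-inverse `a` of the
RI proliferating permutation has odd length `k`, the full cycle type is `k ::ₘ (μ + μ)`
for some multiset `μ` of positive naturals with `k + 2 * μ.sum = n`, and `k ≥ 3` if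
`t = 0`. -/
theorem stmt_9 (n : ℕ) [NeZero n] (hn : Odd n) (hn3 : 3 ≤ n) (t : ZMod n)
    (s : Fin n ≃ ZMod n) (hs : s 0 = 0)
    (σ : Equiv.Perm (ZMod n)) (hσ : ∀ x : ZMod n, σ x = t - s (Fin.rev (s.symm x)))
    (a : ZMod n) (ha : a + a = t) :
    ∃ k : ℕ, Odd k ∧ Set.ncard {y : ZMod n | ∃ m : ℤ, (σ ^ m) a = y} = k ∧
      (∃ μ : Multiset ℕ, (∀ c ∈ μ, 0 < c) ∧ k + 2 * μ.sum = n ∧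
        fullCycleType σ = k ::ₘ (μ + μ)) ∧
      (t = 0 → 3 ≤ k) := by
  have htwo : ∀ x y : ZMod n, x + x = y + y → x = y := by
    intro x y h
    have h2 : IsUnit (2 : ZMod n) := by
      have := (ZMod.isUnit_iff_coprime 2 n).2 (Nat.coprime_two_left.2 hn)
      exact_mod_cast this
    exact h2.mul_left_cancel (by rw [two_mul, two_mul, h])
  have hI : ∀ x, Equiv.subLeft t (Equiv.subLeft t x) = x := fun x => by simp
  have hσI : ∀ x, Equiv.subLeft t (σ x) = s (Fin.rev (s.symm x)) := fun x => by simp [hσ]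
  have hconj : Equiv.subLeft t * σ * (Equiv.subLeft t)⁻¹ = σ⁻¹ := by
    rw [mul_inv_eq_iff_eq_mul]
    ext1 x
    rw [Equiv.Perm.mul_apply, Equiv.Perm.mul_apply, Equiv.Perm.eq_inv_iff_eq, hσI, hσ]
    simp
  obtain ⟨μ, hμ⟩ := exists_fullCycleType_eq_cons_add_self hconj hI (a := a)
    (by simp [← ha])
    (fun x hx => htwo x a (by rw [ha]; exact (sub_eq_iff_eq_add.1 hx).symm))
    (fun x y hx hy => by
      rw [hσI, ← Equiv.eq_symm_apply] at hx hy
      apply s.symm.injective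
      rw [Fin.ext_iff, Fin.val_rev] at hx hy
      ext
      omega)
  have hsum := sum_fullCycleType σ
  rw [hμ, ZMod.card, Multiset.sum_cons, Multiset.sum_add, ← two_mul] at hsum
  have hodd : Odd (Set.ncard {y : ZMod n | ∃ m : ℤ, (σ ^ m) a = y}) := by
    rw [← hsum] at hn
    exact (Nat.odd_add.1 hn).2 (even_two_mul _)
  refine ⟨_, hodd, rfl, ⟨μ, fun c hc => pos_of_mem_fullCycleType (σ := σ) ?_, hsum, hμ⟩, ?_⟩
  · rw [hμ]
    exact Multiset.mem_cons_of_mem (Multiset.mem_add.2 (Or.inl hc))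
  · rintro rfl
    obtain rfl : a = 0 := htwo a 0 (by rw [ha, add_zero])
    have hne : σ 0 ≠ 0 := by
      intro h
      have hs0 : s.symm 0 = 0 := by rw [Equiv.symm_apply_eq, hs]
      rw [hσ, zero_sub, neg_eq_zero, ← hs, s.injective.eq_iff, hs, hs0, Fin.ext_iff,
        Fin.val_rev] at h
      simp at h
      omega
    have hlt : 1 < Set.ncard {y : ZMod n | ∃ m : ℤ, (σ ^ m) 0 = y} :=
      (Set.one_lt_ncard (Set.toFinite _)).2 ⟨σ 0, ⟨1, by simp⟩, 0, ⟨0, by simp⟩, hne⟩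
    obtain ⟨j, hj⟩ := hodd
    omega
end

section
/- Let n be a positive natural number and t : ZMod n with Nat.gcd n t.val = 1. Let μ be a multiset of positive natural numbers with μ.sum = n such that (i) the cardinality of μ is at most n/2 + 1 (natural-number division), and (ii) the number of even elements of μ (with multiplicity) is even if n % 4 = 1 or n % 4 = 2, and odd if n % 4 = 0 or n % 4 = 3. Then there exists a series s : Fin n ≃ ZMod n with s 0 = 0 such that the full cycle type of the proliferating permutation of s under retrogradation with transposition t equals μ. -/
/-- The proliferating permutation of a series `s` under retrogradation with transposition
`t`: `x ↦ s (rev (s.symm x)) + t`. -/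
def ppR {n : ℕ} [NeZero n] (t : ZMod n) (s : Fin n ≃ ZMod n) : Equiv.Perm (ZMod n) :=
  (s.symm.trans (Fin.revPerm.trans s)).trans (Equiv.addRight t)

open Equiv

section ListPerm

variable {α : Type*} [DecidableEq α]

theorem formPerm_append_cons_cons {A B : List α} {q x : α} (h : (A ++ q :: x :: B).Nodup) :
    (A ++ q :: x :: B).formPerm = swap q x * (A ++ x :: B).formPerm := by
  have h' : (A ++ x :: B).Nodup := h.sublist (by simp)
  rw [List.formPerm_eq_of_isRotated h List.isRotated_append,
    List.formPerm_eq_of_isRotated h' List.isRotated_append]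
  simp [List.formPerm_cons_cons]

theorem exists_formPerm_insert {C : List α} {q x : α} (hC : C.Nodup) (hx : x ∈ C) (hq : q ∉ C) :
    ∃ C' : List α, C'.Nodup ∧ C'.Perm (q :: C) ∧ C'.formPerm = swap q x * C.formPerm := by
  obtain ⟨A, B, rfl⟩ := List.append_of_mem hx
  have hp : (A ++ q :: x :: B).Perm (q :: (A ++ x :: B)) := List.perm_middle
  have hn : (A ++ q :: x :: B).Nodup := hp.nodup_iff.2 (List.nodup_cons.2 ⟨hq, hC⟩)
  exact ⟨_, hn, hp, formPerm_append_cons_cons hn⟩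

theorem formPerm_append_singleton_mul (X Y : List α) (z : α) :
    (X ++ [z]).formPerm * (z :: Y).formPerm = (X ++ z :: Y).formPerm := by
  induction X with
  | nil => simp
  | cons a X ih =>
    cases X with
    | nil => simp [List.formPerm_cons_cons]
    | cons b X => simpa [List.formPerm_cons_cons, mul_assoc] using ih

theorem formPerm_cons_append_cons {A B : List α} {p q : α} (h : (p :: A ++ q :: B).Nodup) :
    (p :: A ++ q :: B).formPerm = swap p q * ((q :: B).formPerm * (p :: A).formPerm) := by
  have h1 : ((q :: B) ++ p :: A).Nodup := (List.perm_append_comm.nodup_iff).1 h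
  have h2 : (p :: (q :: B)).Nodup :=
    (List.perm_append_comm.nodup_iff).1 ((h1.sublist (by simp) : ((q :: B) ++ [p]).Nodup))
  rw [List.formPerm_eq_of_isRotated h List.isRotated_append, ← formPerm_append_singleton_mul,
    ← List.formPerm_eq_of_isRotated h2 (List.isRotated_append (l := [p])),
    List.formPerm_cons_cons, mul_assoc]

theorem formPerm_mul_formPerm_eq {A B : List α} {p q : α} (h : (p :: A ++ q :: B).Nodup) :
    (p :: B).formPerm * (q :: A).formPerm = (p :: A ++ q :: B).formPerm * swap p q := by
  have hperm : (p :: B.reverse ++ q :: A.reverse).Perm (p :: A ++ q :: B) := by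
    simp only [List.cons_append]
    refine List.Perm.cons _ (List.perm_middle.trans (.trans (.cons _ ?_) List.perm_middle.symm))
    exact (List.perm_append_comm).trans ((List.reverse_perm A).append (List.reverse_perm B))
  have hn := hperm.nodup_iff.2 h
  have hrot : ∀ (z : α) (X : List α), (z :: X).Nodup →
      (z :: X.reverse).formPerm = (z :: X).formPerm⁻¹ := by
    intro z X hz
    rw [← List.formPerm_reverse]
    apply List.formPerm_eq_of_isRotated
    · simpa using hz
    · simpa using (List.isRotated_append (l := [z]) (l' := X.reverse))
  have hB : (p :: B).Nodup := h.sublist (by simp)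
  have hA : (q :: A).Nodup :=
    ((List.perm_middle (l₁ := A) (l₂ := B) (a := q)).nodup_iff.1
      (List.nodup_cons.1 h).2).sublist (by simp)
  have hM : (p :: B.reverse ++ q :: A.reverse).formPerm = (p :: A ++ q :: B).formPerm⁻¹ := by
    rw [← List.formPerm_reverse]
    apply List.formPerm_eq_of_isRotated hn
    simpa using (List.isRotated_append (l := [p]) (l' := B.reverse ++ q :: A.reverse))
  have key := formPerm_cons_append_cons hn
  rw [hM, hrot p B hB, hrot q A hA, ← mul_inv_rev] at key
  have h3 := congrArg (·⁻¹) key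
  simp only [inv_inv, mul_inv_rev, swap_inv] at h3
  rw [h3, mul_assoc, swap_mul_self, mul_one]

theorem pairwise_commute_formPerm {L : List (List α)} (hL : L.flatten.Nodup) :
    (L.map List.formPerm).Pairwise Commute := by
  rw [List.nodup_flatten] at hL
  rw [List.pairwise_map]
  refine hL.2.imp fun {a b} hab => Perm.Disjoint.commute fun x => ?_
  by_contra! hx
  exact hab (List.mem_of_formPerm_apply_ne hx.1) (List.mem_of_formPerm_apply_ne hx.2)

theorem commute_swap_of_fixed {σ : Perm α} {p q : α} (hp : σ p = p) (hq : σ q = q) :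
    Commute (swap p q) σ := by
  rw [commute_iff_eq, swap_mul_eq_mul_swap, Perm.inv_eq_iff_eq.2 hp.symm,
    Perm.inv_eq_iff_eq.2 hq.symm]

theorem prod_formPerm_apply_of_notMem {L : List (List α)} {x : α} (hx : x ∉ L.flatten) :
    (L.map List.formPerm).prod x = x := by
  induction L with
  | nil => simp
  | cons l L ih =>
    simp only [List.flatten_cons, List.mem_append, not_or] at hx
    simp [ih hx.2, List.formPerm_apply_of_notMem hx.1]

theorem cycleType_prod_formPerm [Fintype α] {L : List (List α)} (hL : L.flatten.Nodup) :
    (L.map List.formPerm).prod.cycleType =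
      ((L.map List.length : List ℕ) : Multiset ℕ).filter (2 ≤ ·) := by
  induction L with
  | nil => simp
  | cons l L ih =>
    rw [List.flatten_cons, List.nodup_append'] at hL
    have hd : Perm.Disjoint l.formPerm (L.map List.formPerm).prod := fun x => by
      by_contra! hx
      refine hL.2.2 (List.mem_of_formPerm_apply_ne hx.1) ?_
      by_contra hx'
      exact hx.2 (prod_formPerm_apply_of_notMem hx')
    rw [List.map_cons, List.prod_cons, hd.cycleType_mul, ih hL.2.1, List.map_cons,
      ← Multiset.cons_coe]
    by_cases hl : 2 ≤ l.length
    · rw [Multiset.filter_cons_of_pos _ hl, ← Multiset.singleton_add,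
        (List.isCycle_formPerm hL.1 hl).cycleType,
        List.support_formPerm_of_nodup _ hL.1 (by rintro x rfl; simp at hl),
        List.toFinset_card_of_nodup hL.1]
    · rw [Multiset.filter_cons_of_neg _ hl, (List.formPerm_eq_one_iff l hL.1).2 (by omega)]
      simp

end ListPerm

theorem fullCycleType_eq {α : Type*} [Fintype α] [DecidableEq α] (σ : Perm α) :
    fullCycleType σ =
      σ.cycleType + Multiset.replicate (Fintype.card α - σ.cycleType.sum) 1 := by
  rw [fullCycleType, Perm.sum_cycleType, ← Finset.card_compl]
  congr 3
  ext x
  simp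

theorem fullCycleType_conj {α : Type*} [Fintype α] [DecidableEq α] (σ g : Perm α) :
    fullCycleType (g * σ * g⁻¹) = fullCycleType σ := by
  rw [fullCycleType_eq, fullCycleType_eq, Perm.cycleType_conj]

theorem filter_two_le_add_replicate {μ : Multiset ℕ} (hμ : ∀ c ∈ μ, 0 < c) :
    μ.filter (2 ≤ ·) + Multiset.replicate (μ.sum - (μ.filter (2 ≤ ·)).sum) 1 = μ := by
  have h1 : μ.filter (¬ 2 ≤ ·) =
      Multiset.replicate (Multiset.card (μ.filter (¬ 2 ≤ ·))) 1 := by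
    refine Multiset.eq_replicate_card.2 fun c hc => ?_
    rw [Multiset.mem_filter] at hc
    have := hμ c hc.1
    omega
  have h2 := Multiset.filter_add_not (2 ≤ ·) μ
  have h3 := congrArg Multiset.sum h2
  have h4 := congrArg Multiset.sum h1
  rw [Multiset.sum_replicate, smul_eq_mul, mul_one] at h4
  rw [Multiset.sum_add, h4] at h3
  conv_rhs => rw [← h2, h1]
  congr 2
  omega

theorem fullCycleType_prod_formPerm {α : Type*} [Fintype α] [DecidableEq α] {L : List (List α)}
    (hL : L.flatten.Nodup) (hmem : ∀ x, x ∈ L.flatten) (hne : [] ∉ L) :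
    fullCycleType (L.map List.formPerm).prod = ((L.map List.length : List ℕ) : Multiset ℕ) := by
  have hcard : Fintype.card α = ((L.map List.length : List ℕ) : Multiset ℕ).sum := by
    rw [Multiset.sum_coe, ← List.length_flatten, ← List.toFinset_card_of_nodup hL,
      ← Finset.card_univ]
    congr 1
    ext x
    simpa using hmem x
  rw [fullCycleType_eq, cycleType_prod_formPerm hL, hcard]
  refine filter_two_le_add_replicate fun c hc => ?_
  obtain ⟨l, hl, rfl⟩ := List.mem_map.1 (Multiset.mem_coe.1 hc)
  exact List.length_pos_iff.2 fun h => hne (h ▸ hl)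

/-- `τ` is an involution of the finite set `S` with at most one fixed point in `S`. -/
structure IsNearMatchingOn {α : Type*} (S : Finset α) (τ : Perm α) : Prop where
  mul_self : τ * τ = 1
  apply_of_notMem : ∀ x ∉ S, τ x = x
  eq_of_fixed : ∀ x ∈ S, ∀ y ∈ S, τ x = x → τ y = y → x = y

/-- A unicellular gluing of the finite set `S` with vertex degrees `μ`: a cyclic order `C` of all of
`S`, an involution `τ` of `S` with at most one fixed point and a family `L` of disjoint cycles
with lengths `μ` such that `C * τ` is the product of the cycles in `L`. -/
def HasUnicellularGluing {α : Type*} [DecidableEq α] (S : Finset α) (μ : Multiset ℕ) : Prop :=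
  ∃ (C : List α) (L : List (List α)) (τ : Perm α), C.Nodup ∧ (∀ x, x ∈ C ↔ x ∈ S) ∧
    L.flatten.Perm C ∧ ((L.map List.length : List ℕ) : Multiset ℕ) = μ ∧ IsNearMatchingOn S τ ∧
    C.formPerm * τ = (L.map List.formPerm).prod

theorem isNearMatchingOn_empty {α : Type*} : IsNearMatchingOn (∅ : Finset α) 1 :=
  ⟨by simp, by simp, by simp⟩

section Gluing

variable {α : Type*} [DecidableEq α]

theorem IsNearMatchingOn.mul_swap {S : Finset α} {τ : Perm α} {p q : α}
    (h : IsNearMatchingOn S τ) (hp : p ∉ S) (hq : q ∉ S) (hpq : p ≠ q) :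
    IsNearMatchingOn (insert p (insert q S)) (τ * swap p q) := by
  have hτp := h.apply_of_notMem p hp
  have hτq := h.apply_of_notMem q hq
  have hswap : Commute (swap p q) τ := commute_swap_of_fixed hτp hτq
  have happ : ∀ y, y ≠ p → y ≠ q → (τ * swap p q) y = τ y := fun y h1 h2 => by
    simp [swap_apply_of_ne_of_ne h1 h2]
  have hfix : ∀ y ∈ insert p (insert q S), (τ * swap p q) y = y → y ∈ S ∧ τ y = y := by
    intro y hy h
    by_cases h1 : y = p
    · subst h1; simp [hτq] at h; exact absurd h.symm hpq
    by_cases h2 : y = q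
    · subst h2; simp [hτp] at h; exact absurd h hpq
    rw [happ y h1 h2] at h
    simp only [Finset.mem_insert, h1, h2, false_or] at hy
    exact ⟨hy, h⟩
  refine ⟨?_, ?_, ?_⟩
  · rw [mul_assoc, ← mul_assoc (swap p q), hswap.eq, mul_assoc, swap_mul_self, mul_one, h.mul_self]
  · intro y hy
    simp only [Finset.mem_insert, not_or] at hy
    rw [happ y hy.1 hy.2.1, h.apply_of_notMem y hy.2.2]
  · intro y hy w hw h1 h2
    exact h.eq_of_fixed y (hfix y hy h1).1 w (hfix w hw h2).1 (hfix y hy h1).2 (hfix w hw h2).2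

theorem HasUnicellularGluing.split {S : Finset α} {μ : Multiset ℕ} {i j : ℕ} {p q : α}
    (h : HasUnicellularGluing S ((i + (j + 1)) ::ₘ μ)) (hp : p ∉ S) (hq : q ∉ S) (hpq : p ≠ q) :
    HasUnicellularGluing (insert p (insert q S)) ((i + 1) ::ₘ (j + 2) ::ₘ μ) := by
  obtain ⟨C, L, τ, hC, hCS, hLC, hLμ, hτ, hprod⟩ := h
  obtain ⟨l, hl, hlen⟩ : ∃ l ∈ L, l.length = i + (j + 1) := by
    have : i + (j + 1) ∈ ((L.map List.length : List ℕ) : Multiset ℕ) := by simp [hLμ]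
    simpa using this
  obtain ⟨L₀, hL₀⟩ : ∃ L₀, L.Perm (l :: L₀) := ⟨_, List.perm_cons_erase hl⟩
  have hflat : (l ++ L₀.flatten).Perm C := by
    simpa using (hL₀.flatten.symm.trans hLC)
  rw [(hL₀.map List.formPerm).prod_eq' (pairwise_commute_formPerm (hLC.nodup_iff.2 hC)),
    List.map_cons, List.prod_cons] at hprod
  have hμ₀ : ((L₀.map List.length : List ℕ) : Multiset ℕ) = μ := by
    rw [Multiset.coe_eq_coe.2 (hL₀.map List.length), List.map_cons, ← Multiset.cons_coe,
      hlen] at hLμ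
    exact (Multiset.cons_inj_right _).1 hLμ
  obtain ⟨A, B, x, rfl, hA, hB⟩ : ∃ A B x, l = A ++ x :: B ∧ A.length = i ∧ B.length = j := by
    have hd : (l.drop i).length = j + 1 := by simp [hlen]
    obtain ⟨x, B, hxB⟩ := List.exists_cons_of_length_eq_add_one hd
    refine ⟨l.take i, B, x, by rw [← hxB, List.take_append_drop], by simp [hlen], ?_⟩
    simpa [hxB] using hd
  have hpC : p ∉ C := by rwa [hCS]
  have hqC : q ∉ C := by rwa [hCS]
  have hnd : (p :: q :: (A ++ x :: B ++ L₀.flatten)).Nodup :=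
    (((hflat.cons q).cons p).nodup_iff).2 (by simp [hpC, hqC, hC, hpq])
  have hxC : x ∈ C := hflat.subset (by simp)
  obtain ⟨C₁, hC₁, hC₁p, hC₁f⟩ := exists_formPerm_insert hC hxC hqC
  have hMp : (p :: (A ++ q :: x :: B)).Perm (p :: q :: (A ++ x :: B)) :=
    List.Perm.cons _ List.perm_middle
  have hM : (p :: (A ++ q :: x :: B)).Nodup := hMp.nodup_iff.2 (hnd.sublist (by simp))
  obtain ⟨z, D, hzD⟩ : ∃ z D, A ++ q :: x :: B = z :: D := by
    cases A <;> simp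
  have hzC₁ : z ∈ C₁ := by
    have hz : z ∈ A ++ q :: x :: B := by simp [hzD]
    have hz' : z ∈ q :: (A ++ x :: B) := List.perm_middle.subset hz
    refine hC₁p.symm.subset ((hflat.cons q).subset ?_)
    exact ((List.sublist_append_left _ L₀.flatten).cons_cons q).subset hz'
  have hpC₁ : p ∉ C₁ := fun h => by simpa [hpq, hpC] using hC₁p.subset h
  obtain ⟨C₂, hC₂, hC₂p, hC₂f⟩ := exists_formPerm_insert hC₁ hzC₁ hpC₁
  have hmerge : (p :: (A ++ q :: x :: B)).formPerm =
      swap p z * swap q x * (A ++ x :: B).formPerm := by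
    rw [hzD, List.formPerm_cons_cons, ← hzD, formPerm_append_cons_cons hM.of_cons, mul_assoc]
  have hnot : ∀ y, y ∉ C → y ∉ L₀.flatten := fun y hy h => hy (hflat.subset (by simp [h]))
  have hswap' : Commute (swap p q) (L₀.map List.formPerm).prod :=
    commute_swap_of_fixed (prod_formPerm_apply_of_notMem (hnot p hpC))
      (prod_formPerm_apply_of_notMem (hnot q hqC))
  have hC₂C : C₂.Perm (p :: q :: C) := hC₂p.trans (hC₁p.cons p)
  refine ⟨C₂, (p :: x :: B) :: (q :: A) :: L₀, τ * swap p q, hC₂, ?_, ?_, ?_,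
    hτ.mul_swap hp hq hpq, ?_⟩
  · intro y
    rw [hC₂C.mem_iff]
    simp [hCS]
  · refine List.Perm.trans ?_ (((hflat.cons q).cons p).trans hC₂C.symm)
    rw [List.perm_iff_count]
    intro y
    simp only [List.flatten_cons, List.count_append, List.count_cons]
    omega
  · simp only [List.map_cons, ← Multiset.cons_coe, List.length_cons, hA, hB, hμ₀]
    exact Multiset.cons_swap _ _ _
  · rw [hC₂f, hC₁f, List.map_cons, List.map_cons, List.prod_cons, List.prod_cons, ← mul_assoc,
      ← mul_assoc (p :: x :: B).formPerm,
      formPerm_mul_formPerm_eq (by simpa using hM), mul_assoc _ (swap p q), hswap'.eq,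
      List.cons_append, hmerge]
    simp only [mul_assoc] at hprod ⊢
    rw [← mul_assoc _ τ, hprod]
    simp only [mul_assoc]

theorem swap_handle {p q r s x : α} (h : [x, p, q, r, s].Nodup) :
    swap p s * (swap s q * (swap q r * (swap r x * (swap r s * swap p q)))) =
      swap p r * (swap r q * (swap q s * swap s x)) := by
  simp only [List.nodup_cons, List.mem_cons, List.not_mem_nil, or_false, not_or] at h
  ext y
  simp only [Perm.mul_apply, swap_apply_def]
  grind

theorem HasUnicellularGluing.add_handle {S : Finset α} {n : ℕ} {p q r s : α}
    (h : HasUnicellularGluing S {n + 1}) (hnd : [p, q, r, s].Nodup)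
    (hp : p ∉ S) (hq : q ∉ S) (hr : r ∉ S) (hs : s ∉ S) :
    HasUnicellularGluing (insert p (insert q (insert r (insert s S)))) {n + 5} := by
  obtain ⟨C, L, τ, hC, hCS, hLC, hLμ, hτ, hprod⟩ := h
  obtain ⟨l, rfl, hlen⟩ : ∃ l, L = [l] ∧ l.length = n + 1 := by
    rw [← Multiset.coe_singleton, Multiset.coe_eq_coe, List.perm_singleton,
      List.map_eq_singleton_iff] at hLμ
    exact hLμ
  obtain ⟨x, B, rfl⟩ := List.exists_cons_of_length_eq_add_one hlen
  simp only [List.flatten_cons, List.flatten_nil, List.append_nil] at hLC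
  simp only [List.map_cons, List.map_nil, List.prod_cons, List.prod_nil, mul_one] at hprod
  have hxS : x ∈ S := (hCS x).1 (hLC.subset (by simp))
  have hxC : x ∈ C := (hCS x).2 hxS
  rw [← hCS] at hp hq hr hs
  simp only [List.nodup_cons, List.mem_cons, List.not_mem_nil, or_false, not_or] at hnd
  obtain ⟨C₁, hC₁, hC₁p, hC₁f⟩ := exists_formPerm_insert hC hxC hr
  obtain ⟨C₂, hC₂, hC₂p, hC₂f⟩ := exists_formPerm_insert (q := q) (x := r) hC₁
    (hC₁p.mem_iff.2 (by simp)) (by rw [hC₁p.mem_iff]; simp [hq, hnd])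
  obtain ⟨C₃, hC₃, hC₃p, hC₃f⟩ := exists_formPerm_insert (q := s) (x := q) hC₂
    (hC₂p.mem_iff.2 (by simp)) (by
      rw [hC₂p.mem_iff, List.mem_cons, hC₁p.mem_iff]; simp only [List.mem_cons]; tauto)
  obtain ⟨C₄, hC₄, hC₄p, hC₄f⟩ := exists_formPerm_insert (q := p) (x := s) hC₃
    (hC₃p.mem_iff.2 (by simp)) (by
      rw [hC₃p.mem_iff, List.mem_cons, hC₂p.mem_iff, List.mem_cons, hC₁p.mem_iff]
      simp only [List.mem_cons]; tauto)
  have hCC : C₄.Perm (p :: s :: q :: r :: C) :=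
    hC₄p.trans ((hC₃p.trans ((hC₂p.trans (hC₁p.cons _)).cons _)).cons _)
  have hpS : p ∉ insert r (insert s S) := by
    simp only [Finset.mem_insert, ← hCS]; tauto
  have hqS : q ∉ insert r (insert s S) := by
    simp only [Finset.mem_insert, ← hCS]; tauto
  refine ⟨C₄, [p :: r :: q :: s :: x :: B], τ * swap r s * swap p q, hC₄, ?_, ?_, ?_,
    (hτ.mul_swap (mt (hCS r).2 hr) (mt (hCS s).2 hs) (by tauto)).mul_swap hpS hqS (by tauto), ?_⟩
  · intro y
    rw [hCC.mem_iff]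
    simp only [List.mem_cons, hCS, Finset.mem_insert]
    tauto
  · refine List.Perm.trans ?_ (((((hLC.cons r).cons q).cons s).cons p).trans hCC.symm)
    rw [List.perm_iff_count]
    intro y
    simp only [List.flatten_cons, List.flatten_nil, List.count_append, List.count_cons,
      List.count_nil]
    omega
  · simpa using hlen
  · rw [hC₄f, hC₃f, hC₂f, hC₁f]
    simp only [List.map_cons, List.map_nil, List.prod_cons, List.prod_nil, mul_one]
    simp only [List.formPerm_cons_cons p r, List.formPerm_cons_cons r q,
      List.formPerm_cons_cons q s, List.formPerm_cons_cons s x, ← hprod]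
    have hfixed : ∀ y, y ∉ C → (C.formPerm * τ) y = y := fun y hy => by
      rw [Perm.mul_apply, hτ.apply_of_notMem y (mt (hCS y).2 hy),
        List.formPerm_apply_of_notMem hy]
    have hrs := commute_swap_of_fixed (hfixed r hr) (hfixed s hs)
    have hpq := commute_swap_of_fixed (hfixed p hp) (hfixed q hq)
    have hx : ∀ y, y ∉ C → x ≠ y := fun y hy h => hy (h ▸ hxC)
    have key := swap_handle (p := p) (q := q) (r := r) (s := s) (x := x) (by
      simp only [List.nodup_cons, List.mem_cons, List.not_mem_nil, or_false, not_or,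
        List.nodup_nil, not_false_eq_true, and_true]
      have := hx p hp; have := hx q hq; have := hx r hr; have := hx s hs
      tauto)
    calc _ = swap p s * (swap s q * (swap q r * (swap r x *
          (C.formPerm * τ * swap r s * swap p q)))) := by simp only [mul_assoc]
      _ = swap p s * (swap s q * (swap q r * (swap r x * (swap r s * swap p q)))) *
          (C.formPerm * τ) := by
        rw [← hrs.eq, mul_assoc, ← hpq.eq]; simp only [mul_assoc]
      _ = _ := by rw [key]; simp only [mul_assoc]

theorem hasUnicellularGluing_four {p q r s : α} (hnd : [p, q, r, s].Nodup) :
    HasUnicellularGluing {p, q, r, s} {4} := by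
  have h := hnd
  simp only [List.nodup_cons, List.mem_cons, List.not_mem_nil, or_false, not_or] at h
  refine ⟨[p, s, q, r], [[p, r, q, s]], 1 * swap r s * swap p q, ?_, ?_, ?_, by simp,
    (isNearMatchingOn_empty.mul_swap (by simp) (by simp) (by tauto)).mul_swap
      (by simp; tauto) (by simp; tauto) (by tauto), ?_⟩
  · simp; tauto
  · intro x; simp; tauto
  · rw [List.perm_iff_count]
    intro y
    simp only [List.flatten_cons, List.flatten_nil, List.count_append, List.count_cons,
      List.count_nil]
    omega
  · ext y
    simp only [List.map_cons, List.map_nil, List.prod_cons, List.prod_nil, mul_one, one_mul,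
      List.formPerm_cons_cons, List.formPerm_singleton, Perm.mul_apply, swap_apply_def]
    grind

theorem hasUnicellularGluing_one (p : α) : HasUnicellularGluing {p} {1} :=
  ⟨[p], [[p]], 1, by simp, by simp, by simp, by simp, ⟨by simp, by simp, by simp⟩, by simp⟩

theorem hasUnicellularGluing_one_one {p q : α} (h : p ≠ q) :
    HasUnicellularGluing {p, q} {1, 1} :=
  ⟨[p, q], [[p], [q]], 1 * swap p q, by simp [h], by simp, by simp, rfl,
    isNearMatchingOn_empty.mul_swap (by simp) (by simp) h, by simp⟩

end Gluing

theorem Finset.exists_insert_insert {α : Type*} [DecidableEq α] {S : Finset α} {n : ℕ}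
    (h : S.card = n + 2) :
    ∃ (p q : α) (T : Finset α), p ∉ T ∧ q ∉ T ∧ p ≠ q ∧ T.card = n ∧ insert p (insert q T) = S := by
  obtain ⟨p, U, hp, rfl, hU⟩ := Finset.card_eq_succ.1 h
  obtain ⟨q, T, hq, rfl, hT⟩ := Finset.card_eq_succ.1 hU
  simp only [Finset.mem_insert, not_or] at hp
  exact ⟨p, q, T, hp.2, hq, hp.1, hT, rfl⟩

theorem hasUnicellularGluing_singleton {α : Type*} [DecidableEq α] (n : ℕ) :
    ∀ S : Finset α, S.card = n + 1 → (n + 1) % 4 ≤ 1 → HasUnicellularGluing S {n + 1} := by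
  induction n using Nat.strong_induction_on with
  | _ n ih =>
    intro S hS hn
    obtain rfl | hn3 : n = 0 ∨ 3 ≤ n := by omega
    · obtain ⟨p, rfl⟩ := Finset.card_eq_one.1 hS
      exact hasUnicellularGluing_one p
    obtain ⟨m, rfl⟩ := Nat.exists_eq_add_of_le' hn3
    obtain ⟨p, q, U, hp, hq, hpq, hU, rfl⟩ := Finset.exists_insert_insert (n := m + 2) hS
    obtain ⟨r, s, T, hr, hs, hrs, hT, rfl⟩ := Finset.exists_insert_insert hU
    simp only [Finset.mem_insert, not_or] at hp hq
    have hnd : [p, q, r, s].Nodup := by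
      simp only [List.nodup_cons, List.mem_cons, List.not_mem_nil, or_false, not_or,
        List.nodup_nil, not_false_eq_true, and_true]
      tauto
    rcases m with _ | m
    · rw [Finset.card_eq_zero.1 hT]
      exact hasUnicellularGluing_four hnd
    · exact (ih m (by omega) T hT (by omega)).add_handle hnd hp.2.2 hq.2.2 hr hs

theorem hasUnicellularGluing_of_card_le {α : Type*} [DecidableEq α] (v : ℕ) :
    ∀ (μ : Multiset ℕ) (S : Finset α), Multiset.card μ = v → (∀ c ∈ μ, 0 < c) → S.card = μ.sum →
      v ≤ μ.sum / 2 + 1 → v % 2 = (μ.sum / 2 + 1) % 2 → HasUnicellularGluing S μ := by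
  induction v with
  | zero =>
    intro μ S hv hpos hS hle hmod
    rw [Multiset.card_eq_zero] at hv
    simp [hv] at hmod
  | succ v ih =>
    intro μ S hv hpos hS hle hmod
    rcases v with _ | v
    · obtain ⟨n, rfl⟩ := Multiset.card_eq_one.1 hv
      have hn := hpos n (by simp)
      obtain ⟨n, rfl⟩ : ∃ k, n = k + 1 := ⟨n - 1, by omega⟩
      rw [Multiset.sum_singleton] at hS hmod
      exact hasUnicellularGluing_singleton n S hS (by omega)
    by_cases hb : ∃ b ∈ μ, 2 ≤ b
    · obtain ⟨b, hbμ, hb⟩ := hb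
      obtain ⟨ν, rfl⟩ := Multiset.exists_cons_of_mem hbμ
      obtain ⟨a, haν⟩ : ∃ a, a ∈ ν := by
        apply Multiset.exists_mem_of_ne_zero
        rintro rfl
        simp at hv
      obtain ⟨μ, rfl⟩ := Multiset.exists_cons_of_mem haν
      have ha := hpos a (by simp)
      obtain ⟨i, rfl⟩ : ∃ i, a = i + 1 := ⟨a - 1, by omega⟩
      obtain ⟨j, rfl⟩ := Nat.exists_eq_add_of_le' hb
      simp only [Multiset.card_cons, Multiset.sum_cons] at hv hS hle hmod
      have hS' : S.card = i + (j + 1) + μ.sum + 2 := by omega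
      obtain ⟨p, q, T, hp, hq, hpq, hT, rfl⟩ := Finset.exists_insert_insert hS'
      rw [Multiset.cons_swap]
      refine (ih ((i + (j + 1)) ::ₘ μ) T (by simp; omega) ?_ (by simpa using hT) ?_ ?_).split
        hp hq hpq
      · intro c hc
        rcases Multiset.mem_cons.1 hc with rfl | hc
        · omega
        · exact hpos c (by simp [hc])
      · rw [Multiset.sum_cons]; omega
      · rw [Multiset.sum_cons]; omega
    · push Not at hb
      have hμ : μ = Multiset.replicate (v + 2) 1 :=
        Multiset.eq_replicate.2 ⟨hv, fun c hc => by have := hpos c hc; have := hb c hc; omega⟩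
      subst hμ
      simp only [Multiset.sum_replicate, smul_eq_mul, mul_one] at hS hle hmod
      obtain rfl : v = 0 := by omega
      obtain ⟨p, q, hpq, rfl⟩ := Finset.card_eq_two.1 hS
      exact hasUnicellularGluing_one_one hpq

theorem card_filter_even_add_sum_mod_two (μ : Multiset ℕ) :
    (Multiset.card (μ.filter fun c => Even c) + μ.sum) % 2 = Multiset.card μ % 2 := by
  induction μ using Multiset.induction_on with
  | empty => simp
  | cons a μ ih =>
    by_cases ha : Even a
    · rw [Multiset.filter_cons_of_pos (p := fun c => Even c) _ ha, Multiset.card_cons,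
        Multiset.card_cons, Multiset.sum_cons]
      rw [Nat.even_iff] at ha
      omega
    · rw [Multiset.filter_cons_of_neg (p := fun c => Even c) _ ha, Multiset.card_cons,
        Multiset.sum_cons]
      rw [Nat.even_iff] at ha
      omega

theorem cycleType_eq_replicate_of_isNearMatchingOn {α : Type*} [Fintype α] [DecidableEq α]
    {τ : Perm α} (h : IsNearMatchingOn Finset.univ τ) :
    τ.cycleType = Multiset.replicate (Fintype.card α / 2) 2 := by
  have hrep := Perm.cycleType_of_pow_prime_eq_one (σ := τ) (p := 2) (by rw [pow_two, h.mul_self])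
  have hsum := τ.sum_cycleType
  rw [hrep, Multiset.sum_replicate, smul_eq_mul] at hsum
  have hle : τ.supportᶜ.card ≤ 1 := Finset.card_le_one.2 fun a ha b hb =>
    h.eq_of_fixed a (Finset.mem_univ a) b (Finset.mem_univ b) (by simpa using ha)
      (by simpa using hb)
  have hadd := Finset.card_add_card_compl τ.support
  rw [hrep]
  congr 1
  omega

theorem isNearMatchingOn_revPerm (n : ℕ) :
    IsNearMatchingOn Finset.univ (Fin.revPerm : Perm (Fin n)) := by
  refine ⟨by ext; simp, by simp, fun x _ y _ hx hy => ?_⟩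
  simp only [Fin.revPerm_apply, Fin.ext_iff, Fin.val_rev] at *
  omega

theorem IsNearMatchingOn.conj {α β : Type*} [Fintype α] [Fintype β] {τ : Perm α} (e : α ≃ β)
    (h : IsNearMatchingOn Finset.univ τ) : IsNearMatchingOn Finset.univ (e.permCongr τ) := by
  refine ⟨?_, by simp, fun x _ y _ hx hy => ?_⟩
  · ext x
    have := DFunLike.congr_fun h.mul_self (e.symm x)
    simp only [Perm.mul_apply, Perm.one_apply] at this
    simp [this]
  · rw [permCongr_apply, ← eq_symm_apply] at hx hy
    exact e.symm.injective (h.eq_of_fixed _ (Finset.mem_univ _) _ (Finset.mem_univ _) hx hy)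

theorem exists_conj_formPerm_eq_addRight {n : ℕ} [NeZero n] {t : ZMod n} (ht : IsUnit t)
    {C : List (ZMod n)} (hC : C.Nodup) (hmem : ∀ x, x ∈ C) :
    ∃ g : Perm (ZMod n), g * C.formPerm * g⁻¹ = Equiv.addRight t := by
  have hlen : C.length = n := by
    rw [← List.toFinset_card_of_nodup hC,
      Finset.eq_univ_of_forall fun x => List.mem_toFinset.2 (hmem x), Finset.card_univ, ZMod.card]
  have hinj : Function.Injective fun x : ZMod n => (C.idxOf x : ZMod n) * t := by
    intro x y hxy
    have h1 : (C.idxOf x : ZMod n) = C.idxOf y := ht.mul_left_injective hxy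
    rw [ZMod.natCast_eq_natCast_iff', Nat.mod_eq_of_lt, Nat.mod_eq_of_lt] at h1
    · exact (List.idxOf_inj (hmem x)).1 h1
    · exact (List.idxOf_lt_length_of_mem (hmem y)).trans_eq hlen
    · exact (List.idxOf_lt_length_of_mem (hmem x)).trans_eq hlen
  let g : Perm (ZMod n) := Equiv.ofBijective _ (Finite.injective_iff_bijective.1 hinj)
  have hg : ∀ x, g x = (C.idxOf x : ZMod n) * t := fun _ => rfl
  refine ⟨g, mul_inv_eq_iff_eq_mul.2 (Equiv.ext fun x => ?_)⟩
  have hx := List.idxOf_lt_length_of_mem (hmem x)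
  have hC' : C.formPerm x = C[(C.idxOf x + 1) % C.length]'(Nat.mod_lt _ (by omega)) := by
    conv_lhs => rw [← List.getElem_idxOf hx]
    exact List.formPerm_apply_getElem C hC _ hx
  rw [Perm.mul_apply, Perm.mul_apply, hC', hg, hC.idxOf_getElem, Equiv.coe_addRight, hg, hlen,
    ZMod.natCast_mod]
  push_cast
  ring

theorem exists_series_of_isNearMatchingOn {n : ℕ} [NeZero n] (t : ZMod n) {τ : Perm (ZMod n)}
    (hτ : IsNearMatchingOn Finset.univ τ) :
    ∃ s : Fin n ≃ ZMod n, s 0 = 0 ∧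
      fullCycleType (ppR t s) = fullCycleType (Equiv.addRight t * τ) := by
  let e : Fin n ≃ ZMod n := (ZMod.finEquiv n).toEquiv
  have hconj : IsConj (e.permCongr Fin.revPerm) τ := by
    rw [Perm.isConj_iff_cycleType_eq, cycleType_eq_replicate_of_isNearMatchingOn hτ,
      cycleType_eq_replicate_of_isNearMatchingOn ((isNearMatchingOn_revPerm n).conj e)]
  obtain ⟨g, rfl⟩ := isConj_iff.1 hconj
  let d : Perm (ZMod n) := Equiv.addRight (-g (e 0))
  refine ⟨(e.trans g).trans d, by simp [d], ?_⟩
  refine Eq.trans ?_ (fullCycleType_conj _ d)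
  congr 1
  refine eq_mul_inv_iff_mul_eq.2 (Equiv.ext fun x => ?_)
  simp only [ppR, Perm.mul_apply, Equiv.trans_apply, Equiv.permCongr_apply, Perm.inv_def,
    Equiv.symm_trans_apply, Equiv.symm_apply_apply]
  simp only [d, Equiv.coe_addRight]
  ring

/-- for `gcd n t.val = 1`, every multiset `μ` of positive naturals summing
to `n`, with at most `n/2 + 1` elements and with number of even elements of the correct
parity (even if `n % 4 ∈ {1, 2}`, odd if `n % 4 ∈ {0, 3}`), is realized as the full cycle
type of the R proliferating permutation of some series. -/
theorem stmt_17 (n : ℕ) [NeZero n] (t : ZMod n) (ht : Nat.gcd n t.val = 1)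
    (μ : Multiset ℕ) (hμ : ∀ c ∈ μ, 0 < c) (hsum : μ.sum = n)
    (hcard : Multiset.card μ ≤ n / 2 + 1)
    (heven : (n % 4 = 1 ∨ n % 4 = 2) → Even (Multiset.card (μ.filter fun c => Even c)))
    (hodd : (n % 4 = 0 ∨ n % 4 = 3) → Odd (Multiset.card (μ.filter fun c => Even c))) :
    ∃ s : Fin n ≃ ZMod n, s 0 = 0 ∧ fullCycleType (ppR t s) = μ := by
  have hpar := card_filter_even_add_sum_mod_two μ
  rw [hsum] at hpar
  have hmod : Multiset.card μ % 2 = (n / 2 + 1) % 2 := by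
    have heven' := fun h => Nat.even_iff.1 (heven h)
    have hodd' := fun h => Nat.odd_iff.1 (hodd h)
    omega
  obtain ⟨C, L, τ, hC, hCS, hLC, hLμ, hτ, hprod⟩ :=
    hasUnicellularGluing_of_card_le (Multiset.card μ) μ (Finset.univ : Finset (ZMod n)) rfl hμ
      (by rw [Finset.card_univ, ZMod.card, hsum]) (by rwa [hsum]) (by rwa [hsum])
  have hmem : ∀ x, x ∈ C := fun x => (hCS x).2 (Finset.mem_univ x)
  have hunit : IsUnit t := by
    rw [← ZMod.natCast_zmod_val t, ZMod.isUnit_iff_coprime]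
    exact Nat.Coprime.symm ht
  obtain ⟨g, hg⟩ := exists_conj_formPerm_eq_addRight hunit hC hmem
  obtain ⟨s, hs, hst⟩ := exists_series_of_isNearMatchingOn t (hτ.conj g)
  refine ⟨s, hs, hst.trans ?_⟩
  have hne : [] ∉ L := fun h => by
    have : 0 ∈ μ := by
      rw [← hLμ]
      exact Multiset.mem_coe.2 (List.mem_map.2 ⟨[], h, rfl⟩)
    exact (hμ 0 this).false
  have hgτ : g.permCongr τ = g * τ * g⁻¹ := rfl
  rw [← hg, hgτ, ← hLμ, ← fullCycleType_prod_formPerm (hLC.nodup_iff.2 hC)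
    (fun x => hLC.mem_iff.2 (hmem x)) hne, ← hprod, ← fullCycleType_conj (C.formPerm * τ) g]
  congr 1
  group
end
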